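/- arXiv:1710.11033 — 2 statements merged into one kernel-verified Lean document; each statement's English description precedes it below -/
import Mathlib

section
/- For any finite set I of positive integers with m = max(I ∪ {0}) and any integer n ≥ m + 2, the descent polynomial satisfies d(I;n) ≥ |d(I;−1)|. -/
/-- The descent set of a permutation of `Fin n`, with positions 1-indexed:
`i ∈ descSet n π` iff `1 ≤ i ≤ n-1` and `π_i > π_{i+1}` (1-indexed entries). -/
def descSet (n : ℕ) (π : Equiv.Perm (Fin n)) : Finset ℕ :=
  (Finset.range n).filter fun i =>
    ∃ h : 0 < i ∧ i < n, π ⟨i, h.2⟩ < π ⟨i - 1, by omega⟩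

/-- `dA I n` is the number of permutations in `S_n` with descent set exactly `I`. -/
def dA (I : Finset ℕ) (n : ℕ) : ℕ :=
  (Finset.univ.filter fun π : Equiv.Perm (Fin n) => descSet n π = I).card

/-- Number of permutations of size `N+1` with descent pattern `I` and last value `k`, by recursion. -/
def gCount (I : Finset ℕ) : ℕ → ℕ → ℕ
  | 0, k => if k = 0 then 1 else 0
  | N + 1, k => if N + 1 ∈ I then ∑ j ∈ Finset.Ico k (N + 1), gCount I N j
      else ∑ j ∈ Finset.range k, gCount I N j

/-- Total number of permutations of size `N+1` with pattern `I`. -/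
def dCount (I : Finset ℕ) (N : ℕ) : ℕ := ∑ k ∈ Finset.range (N + 1), gCount I N k

/-- The permutations of size `N+1` with pattern `I`. -/
def patSet (I : Finset ℕ) (N : ℕ) : Finset (Equiv.Perm (Fin (N + 1))) :=
  Finset.univ.filter fun π => ∀ i : Fin N, π i.succ < π i.castSucc ↔ (i : ℕ) + 1 ∈ I

/-- Append a last value `k` to a permutation. -/
def appendLast {N : ℕ} (k : Fin (N + 1)) (σ : Equiv.Perm (Fin N)) : Equiv.Perm (Fin (N + 1)) :=
  ((finSuccEquiv' (Fin.last N)).trans σ.optionCongr).trans (finSuccEquiv' k).symm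

theorem appendLast_last {N : ℕ} (k : Fin (N + 1)) (σ : Equiv.Perm (Fin N)) :
    appendLast k σ (Fin.last N) = k := by
  simp [appendLast]

theorem appendLast_castSucc {N : ℕ} (k : Fin (N + 1)) (σ : Equiv.Perm (Fin N)) (i : Fin N) :
    appendLast k σ i.castSucc = k.succAbove (σ i) := by
  simp [appendLast, finSuccEquiv'_last_apply_castSucc]

theorem appendLast_inj {N : ℕ} (k : Fin (N + 1)) : Function.Injective (appendLast k) := by
  intro σ τ h
  ext i
  have := congrArg (fun e => e i.castSucc) h
  simp only [appendLast_castSucc] at this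
  rw [Fin.succAbove_right_injective this]

theorem appendLast_surj {N : ℕ} (π : Equiv.Perm (Fin (N + 1))) :
    ∃ σ, appendLast (π (Fin.last N)) σ = π := by
  have h : ∀ i : Fin N, ∃ j, (π (Fin.last N)).succAbove j = π i.castSucc := by
    intro i
    apply Fin.exists_succAbove_eq
    intro h
    exact (Fin.castSucc_lt_last i).ne (π.injective h)
  choose f hf using h
  have hinj : Function.Injective f := by
    intro a b hab
    have : π a.castSucc = π b.castSucc := by rw [← hf, ← hf, hab]
    exact Fin.castSucc_injective _ (π.injective this)
  refine ⟨Equiv.ofBijective f (Finite.injective_iff_bijective.mp hinj), ?_⟩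
  refine Equiv.ext fun x => ?_
  induction x using Fin.lastCases with
  | last => rw [appendLast_last]
  | cast i => rw [appendLast_castSucc, ← hf]; rfl

theorem appendLast_mem {N : ℕ} (I : Finset ℕ) (k : Fin (N + 2)) (σ : Equiv.Perm (Fin (N + 1))) :
    appendLast k σ ∈ patSet I (N + 1) ↔
      σ ∈ patSet I N ∧ (k ≤ (σ (Fin.last N)).castSucc ↔ N + 1 ∈ I) := by
  simp only [patSet, Finset.mem_filter, Finset.mem_univ, true_and]
  constructor
  · intro h
    constructor
    · intro i
      have := h i.castSucc
      rw [← Fin.castSucc_succ, appendLast_castSucc, appendLast_castSucc,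
        Fin.succAbove_lt_succAbove_iff] at this
      simpa using this
    · have := h (Fin.last N)
      rw [Fin.succ_last, appendLast_last, appendLast_castSucc, Fin.lt_succAbove_iff_le_castSucc] at this
      simpa using this
  · rintro ⟨h1, h2⟩ i
    induction i using Fin.lastCases with
    | last =>
      rw [Fin.succ_last, appendLast_last, appendLast_castSucc, Fin.lt_succAbove_iff_le_castSucc]
      simpa using h2
    | cast i =>
      rw [← Fin.castSucc_succ, appendLast_castSucc, appendLast_castSucc,
        Fin.succAbove_lt_succAbove_iff]
      simpa using h1 i

theorem card_step (I : Finset ℕ) (N : ℕ) (k : Fin (N + 2)) :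
    ((patSet I (N + 1)).filter fun π => π (Fin.last (N + 1)) = k).card =
    ((patSet I N).filter fun σ => (k ≤ (σ (Fin.last N)).castSucc ↔ N + 1 ∈ I)).card := by
  symm
  apply Finset.card_bij (fun σ _ => appendLast k σ)
  · intro σ hσ
    rw [Finset.mem_filter] at hσ ⊢
    exact ⟨(appendLast_mem I k σ).2 hσ, appendLast_last k σ⟩
  · intro σ _ τ _ h
    exact appendLast_inj k h
  · intro π hπ
    rw [Finset.mem_filter] at hπ
    obtain ⟨h1, h2⟩ := hπ
    obtain ⟨σ, hσ⟩ := appendLast_surj π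
    rw [h2] at hσ
    refine ⟨σ, ?_, hσ⟩
    rw [Finset.mem_filter]
    exact (appendLast_mem I k σ).1 (hσ ▸ h1)

theorem card_last (I : Finset ℕ) (N : ℕ) : ∀ k : ℕ, k ≤ N →
    ((patSet I N).filter fun π => (π (Fin.last N) : ℕ) = k).card = gCount I N k := by
  induction N with
  | zero =>
    intro k hk
    obtain rfl : k = 0 := by omega
    have : (patSet I 0).filter (fun π => (π (Fin.last 0) : ℕ) = 0) = Finset.univ := by
      ext π
      simp [patSet]
    rw [this]
    simp [gCount]
  | succ N ih =>
    intro k hk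
    have h1 := card_step I N ⟨k, by omega⟩
    have h2 : ((patSet I (N + 1)).filter fun π => (π (Fin.last (N + 1)) : ℕ) = k) =
        ((patSet I (N + 1)).filter fun π => π (Fin.last (N + 1)) = ⟨k, by omega⟩) := by
      ext π
      simp [Fin.ext_iff]
    rw [h2, h1, gCount]
    have key : ∀ t : Finset ℕ, (∀ j, j ∈ t ↔ j ≤ N ∧ (k ≤ j ↔ N + 1 ∈ I)) →
        ((patSet I N).filter fun σ => ((⟨k, by omega⟩ : Fin (N + 2)) ≤ (σ (Fin.last N)).castSucc
          ↔ N + 1 ∈ I)).card = ∑ j ∈ t, gCount I N j := by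
      intro t ht
      rw [Finset.card_eq_sum_card_fiberwise (f := fun σ => (σ (Fin.last N) : ℕ)) (t := t)]
      · apply Finset.sum_congr rfl
        intro j hj
        rw [← ih j ((ht j).1 hj).1, Finset.filter_filter]
        congr 1
        apply Finset.filter_congr
        intro σ _
        constructor
        · exact fun h => h.2
        · intro h
          refine ⟨?_, h⟩
          rw [Fin.le_def]
          simp only [Fin.val_castSucc, h]
          exact ((ht j).1 hj).2
      · intro σ hσ
        simp only [Finset.coe_filter, Set.mem_ofPred_eq, Fin.le_def, Fin.val_castSucc] at hσ
        exact (ht _).2 ⟨Nat.lt_succ_iff.1 (σ (Fin.last N)).isLt, hσ.2⟩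
    split_ifs with hI
    · apply key
      intro j
      simp only [Finset.mem_Ico, hI, iff_true]
      omega
    · apply key
      intro j
      simp only [Finset.mem_range, hI, iff_false]
      omega

theorem card_patSet (I : Finset ℕ) (N : ℕ) : (patSet I N).card = dCount I N := by
  rw [Finset.card_eq_sum_card_fiberwise (f := fun σ => (σ (Fin.last N) : ℕ))
    (t := Finset.range (N + 1)), dCount]
  · apply Finset.sum_congr rfl
    intro j hj
    rw [Finset.mem_range] at hj
    exact card_last I N j (by omega)
  · intro σ _
    simpa using Nat.lt_succ_iff.1 (σ (Fin.last N)).isLt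

theorem dA_eq (I : Finset ℕ) (h0 : 0 ∉ I) (N : ℕ) (hI : ∀ i ∈ I, i ≤ N) :
    dA I (N + 1) = dCount I N := by
  rw [← card_patSet, dA, patSet]
  congr 1
  apply Finset.filter_congr
  intro π _
  constructor
  · rintro h i
    rw [← h]
    simp only [descSet, Finset.mem_filter, Finset.mem_range]
    constructor
    · intro hlt
      exact ⟨by omega, ⟨by omega, by omega⟩, hlt⟩
    · rintro ⟨_, _, hlt⟩
      exact hlt
  · intro h
    ext i
    simp only [descSet, Finset.mem_filter, Finset.mem_range]
    constructor
    · rintro ⟨_, ⟨h1, h2⟩, hlt⟩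
      obtain ⟨j, rfl⟩ : ∃ j, i = j + 1 := ⟨i - 1, by omega⟩
      exact (h ⟨j, by omega⟩).1 hlt
    · intro hi
      have hle := hI i hi
      have hne : i ≠ 0 := fun h => h0 (h ▸ hi)
      obtain ⟨j, rfl⟩ : ∃ j, i = j + 1 := ⟨i - 1, by omega⟩
      exact ⟨by omega, ⟨by omega, by omega⟩, (h ⟨j, by omega⟩).2 hi⟩

theorem dCount_mono_succ (I : Finset ℕ) (N : ℕ) (h : N + 1 ∉ I) :
    dCount I N ≤ dCount I (N + 1) := by
  rw [dCount.eq_1 I (N + 1), Finset.sum_range_succ]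
  have : gCount I (N + 1) (N + 1) = dCount I N := by
    rw [gCount, if_neg h, dCount]
  omega

theorem dCount_mono (I : Finset ℕ) (N K : ℕ) (hNK : N ≤ K) (h : ∀ i ∈ I, i ≤ N) :
    dCount I N ≤ dCount I K := by
  induction K, hNK using Nat.le_induction with
  | base => exact le_rfl
  | succ K hK ih =>
    refine ih.trans (dCount_mono_succ I K fun hm => ?_)
    have := h _ hm
    omega

theorem gCount_congr (I J : Finset ℕ) (N : ℕ) (h : ∀ i ≤ N, (i ∈ I ↔ i ∈ J)) (k : ℕ) :
    gCount I N k = gCount J N k := by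
  induction N generalizing k with
  | zero => rfl
  | succ N ih =>
    have ih' := ih fun i hi => h i (by omega)
    simp only [gCount, ih', h (N + 1) le_rfl]

theorem sum_range_choose_col (k r : ℕ) :
    ∑ j ∈ Finset.range k, j.choose r = k.choose (r + 1) := by
  induction k with
  | zero => simp
  | succ k ih => rw [Finset.sum_range_succ, ih, Nat.choose_succ_succ, add_comm]

theorem gCount_insert_self (J : Finset ℕ) (M : ℕ) (k : ℕ) : gCount (insert (M + 1) J) (M + 1) k =
    ∑ j ∈ Finset.Ico k (M + 1), gCount J M j := by
  rw [gCount, if_pos (Finset.mem_insert_self _ _)]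
  apply Finset.sum_congr rfl
  intro j _
  apply gCount_congr
  intro i hi
  rw [Finset.mem_insert]
  constructor
  · rintro (h | h)
    · omega
    · exact h
  · exact Or.inr

theorem gCount_not (J : Finset ℕ) (M : ℕ) (hJ : ∀ j ∈ J, j < M + 1)
    (N : ℕ) (hN : M ≤ N) (k : ℕ) :
    gCount J (N + 1) k = ∑ j ∈ Finset.range k, gCount J N j := by
  rw [gCount, if_neg]
  intro h
  have := hJ _ h
  omega

theorem gCount_add (J : Finset ℕ) (M : ℕ) (hJ : ∀ j ∈ J, j < M + 1)
    (r k : ℕ) (hk : k ≤ M + 1 + r) :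
    gCount (insert (M + 1) J) (M + 1 + r) k + gCount J (M + 1 + r) k =
      dCount J M * k.choose r := by
  induction r generalizing k with
  | zero =>
    rw [add_zero, gCount_insert_self J M, gCount_not J M hJ M le_rfl, add_comm,
      Finset.sum_range_add_sum_Ico _ (by omega), dCount, Nat.choose_zero_right, mul_one]
  | succ r ih =>
    rw [← add_assoc, gCount_not J M hJ (M + 1 + r) (by omega), gCount, if_neg, ← Finset.sum_add_distrib,
      ← sum_range_choose_col, Finset.mul_sum]
    · apply Finset.sum_congr rfl
      intro j hj
      rw [Finset.mem_range] at hj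
      exact ih j (by omega)
    · rw [Finset.mem_insert]
      rintro (h | h)
      · omega
      · have := hJ _ h
        omega

theorem dCount_add (J : Finset ℕ) (M : ℕ) (hJ : ∀ j ∈ J, j < M + 1)
    (r : ℕ) :
    dCount (insert (M + 1) J) (M + 1 + r) + dCount J (M + 1 + r) =
      dCount J M * (M + 1 + r + 1).choose (M + 1) := by
  rw [dCount, dCount.eq_1 J (M + 1 + r), ← Finset.sum_add_distrib]
  have : (M + 1 + r + 1).choose (M + 1) = (M + 1 + r + 1).choose (r + 1) :=
    Nat.choose_symm_of_eq_add (by omega)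
  rw [this, ← sum_range_choose_col, Finset.mul_sum]
  apply Finset.sum_congr rfl
  intro j hj
  rw [Finset.mem_range] at hj
  exact gCount_add J M hJ r j (by omega)

theorem dCount_ineq (J : Finset ℕ) (M : ℕ) (hJ : ∀ j ∈ J, j < M + 1) :
    dCount J M + dCount J (M + 1) ≤ dCount (insert (M + 1) J) (M + 2) := by
  have h1 : dCount J (M + 1) ≤ (M + 1) * dCount J M := by
    rw [dCount, Finset.sum_range_succ', gCount_not J M hJ M le_rfl 0]
    simp only [Finset.range_zero, Finset.sum_empty, add_zero]
    refine (Finset.sum_le_card_nsmul _ _ (dCount J M) ?_).trans (by simp)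
    intro k hk
    rw [Finset.mem_range] at hk
    rw [gCount_not J M hJ M le_rfl, dCount]
    exact Finset.sum_le_sum_of_subset (Finset.range_mono (by omega))
  have h2 : (M + 2) * dCount J M ≤ dCount (insert (M + 1) J) (M + 2) := by
    rw [dCount.eq_1 _ (M + 2), Finset.sum_range_succ']
    refine le_trans ?_ (Nat.le_add_right _ _)
    refine le_trans (by simp) (Finset.card_nsmul_le_sum _ _ (dCount J M) ?_)
    intro k hk
    rw [gCount, if_neg]
    · have h0 : dCount J M = gCount (insert (M + 1) J) (M + 1) 0 := by
        rw [gCount_insert_self J M, dCount, Finset.range_eq_Ico]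
      rw [h0]
      exact Finset.single_le_sum (f := fun j => gCount (insert (M + 1) J) (M + 1) j)
        (fun _ _ => Nat.zero_le _) (Finset.mem_range.2 (Nat.succ_pos k))
    · rw [Finset.mem_insert]
      rintro (h | h)
      · omega
      · have := hJ _ h
        omega
  calc _ ≤ dCount J M + (M + 1) * dCount J M := by omega
    _ = (M + 2) * dCount J M := by ring
    _ ≤ _ := h2

theorem exists_binom_poly (m : ℕ) : ∃ B : Polynomial ℚ,
    (∀ n : ℕ, B.eval (n : ℚ) = (n.choose m : ℚ)) ∧ B.eval (-1) = (-1) ^ m := by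
  induction m with
  | zero => exact ⟨1, by simp, by simp⟩
  | succ m ih =>
    obtain ⟨B, h1, h2⟩ := ih
    have hm : (m : ℚ) + 1 ≠ 0 := by positivity
    refine ⟨Polynomial.C (1 / ((m : ℚ) + 1)) * (Polynomial.X - Polynomial.C (m : ℚ)) * B, ?_, ?_⟩
    · intro n
      simp only [Polynomial.eval_mul, Polynomial.eval_C, Polynomial.eval_sub, Polynomial.eval_X, h1]
      have := Nat.choose_succ_right_eq n m
      rcases le_or_gt m n with h | h
      · have h3 : ((n.choose (m + 1) : ℕ) : ℚ) * (m + 1) = n.choose m * (n - m) := by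
          rw [← Nat.cast_sub h]
          exact_mod_cast this
        field_simp
        linarith
      · rw [Nat.choose_eq_zero_of_lt h, Nat.choose_eq_zero_of_lt (by omega)]
        simp
    · simp only [Polynomial.eval_mul, Polynomial.eval_C, Polynomial.eval_sub, Polynomial.eval_X, h2]
      field_simp
      ring

theorem exists_desc_poly (I : Finset ℕ) : 0 ∉ I → ∃ p : Polynomial ℚ,
    ∀ N : ℕ, (∀ i ∈ I, i ≤ N) → p.eval ((N : ℚ) + 1) = dCount I N ∧
      |p.eval (-1)| ≤ (dCount I (N + 1) : ℚ) := by
  induction I using Finset.induction_on_max with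
  | empty =>
    intro _
    have key : ∀ N, dCount ∅ N = 1 := by
      intro N
      have hg : ∀ k, k ≤ N → gCount ∅ N k = if k = N then 1 else 0 := by
        induction N with
        | zero => intro k hk; simp [gCount]
        | succ N ih =>
          intro k hk
          rw [gCount, if_neg (Finset.notMem_empty _)]
          rw [Finset.sum_congr rfl (g := fun j => if j = N then 1 else 0)]
          · rw [Finset.sum_ite_eq']
            simp only [Finset.mem_range]
            congr 1
            apply propext
            omega
          · intro j hj
            rw [Finset.mem_range] at hj
            exact ih j (by omega)
      rw [dCount, Finset.sum_congr rfl (g := fun j => if j = N then 1 else 0)]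
      · simp
      · intro j hj
        rw [Finset.mem_range] at hj
        exact hg j (by omega)
    exact ⟨1, fun N _ => by simp [key]⟩
  | insert m J hJ ih =>
    intro h0
    rw [Finset.mem_insert, not_or] at h0
    obtain ⟨q, hq⟩ := ih h0.2
    obtain ⟨M, rfl⟩ : ∃ M, m = M + 1 := ⟨m - 1, by omega⟩
    obtain ⟨B, hB1, hB2⟩ := exists_binom_poly (M + 1)
    refine ⟨Polynomial.C (dCount J M : ℚ) * B - q, ?_⟩
    intro N hN
    have hMN := hN _ (Finset.mem_insert_self _ _)
    obtain ⟨r, rfl⟩ := Nat.exists_eq_add_of_le hMN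
    constructor
    · rw [Polynomial.eval_sub, Polynomial.eval_mul, Polynomial.eval_C,
        (hq (M + 1 + r) fun i hi => hN i (Finset.mem_insert_of_mem hi)).1]
      have hb := hB1 (M + 1 + r + 1)
      rw [Nat.cast_succ] at hb
      rw [hb]
      have := dCount_add J M hJ r
      have h : ((dCount (insert (M + 1) J) (M + 1 + r) : ℕ) : ℚ) + dCount J (M + 1 + r) =
        dCount J M * ((M + 1 + r + 1).choose (M + 1) : ℕ) := by exact_mod_cast this
      linarith
    · rw [Polynomial.eval_sub, Polynomial.eval_mul, Polynomial.eval_C, hB2]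
      have h1 := (hq M fun i hi => Nat.lt_succ_iff.1 (hJ i hi)).2
      have h2 := dCount_ineq J M hJ
      have h3 := dCount_mono (insert (M + 1) J) (M + 2) (M + 1 + r + 1) (by omega) (by
        intro i hi
        rw [Finset.mem_insert] at hi
        rcases hi with hi | hi
        · omega
        · have := hJ i hi
          omega)
      have h4 : ((dCount J M : ℕ) : ℚ) + dCount J (M + 1) ≤
        dCount (insert (M + 1) J) (M + 1 + r + 1) := by exact_mod_cast h2.trans h3
      calc _ ≤ |(dCount J M : ℚ) * (-1) ^ (M + 1)| + |q.eval (-1)| := abs_sub _ _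
        _ = dCount J M + |q.eval (-1)| := by simp [abs_mul, abs_pow]
        _ ≤ _ := by linarith

/-- Proposition 3.9: for `n ≥ m + 2`, `d(I;n) ≥ |d(I;−1)|`. -/
theorem stmt_10 (I : Finset ℕ) (h0 : 0 ∉ I) (m : ℕ) (hm : m = I.sup id)
    (p : Polynomial ℚ) (hp : ∀ n : ℕ, m < n → p.eval (n : ℚ) = dA I n) :
    ∀ n : ℕ, m + 2 ≤ n → |p.eval (-1)| ≤ (dA I n : ℚ) := by
  intro n hn
  obtain ⟨q, hq⟩ := exists_desc_poly I h0
  have hle : ∀ i ∈ I, i ≤ m := fun i hi => hm ▸ Finset.le_sup (f := id) hi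
  have hpq : p = q := by
    apply Polynomial.eq_of_infinite_eval_eq
    refine Set.Infinite.mono (s := Set.range fun r : ℕ => ((m + r + 1 : ℕ) : ℚ)) ?_ ?_
    · rintro _ ⟨r, rfl⟩
      rw [Set.mem_ofPred_eq, hp _ (by omega),
        dA_eq I h0 (m + r) (fun i hi => (hle i hi).trans (by omega)),
        ← (hq (m + r) (fun i hi => (hle i hi).trans (by omega))).1]
      simp only [Nat.cast_succ]
    · apply Set.infinite_range_of_injective
      intro a b hab
      have : m + a + 1 = m + b + 1 := Nat.cast_injective (R := ℚ) hab
      omega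
  obtain ⟨N, rfl⟩ : ∃ N, n = N + 1 + 1 := ⟨n - 2, by omega⟩
  rw [hpq, dA_eq I h0 (N + 1) (fun i hi => (hle i hi).trans (by omega))]
  exact (hq N (fun i hi => (hle i hi).trans (by omega))).2
end

section
/- For any finite set I of positive integers with m = max(I ∪ {0}), the sign of d(I;−1) is (−1)^m; that is, (−1)^m · d(I;−1) ≥ 0. -/
open Finset Polynomial

theorem mem_descSet' (n : ℕ) (π : Equiv.Perm (Fin n)) (i : ℕ) :
    i ∈ descSet n π ↔ ∃ h : 0 < i ∧ i < n, π ⟨i, h.2⟩ < π ⟨i - 1, by omega⟩ := by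
  unfold descSet
  rw [Finset.mem_filter, Finset.mem_range]
  constructor
  · rintro ⟨_, h⟩; exact h
  · intro h; exact ⟨h.1.2, h⟩

theorem cardCompl {m k : ℕ} (S : Finset (Fin (m + k))) (h : S.card = m) : Sᶜ.card = k := by
  rw [Finset.card_compl, h, Fintype.card_fin]; omega

/-- glue a permutation of the first block with an increasing second block -/
def glue (m k : ℕ) (S : Finset (Fin (m + k))) (h : S.card = m) (σ : Equiv.Perm (Fin m)) :
    Equiv.Perm (Fin (m + k)) :=
  finSumFinEquiv.symm.trans
    ((Equiv.Perm.sumCongr σ 1).trans (finSumEquivOfFinset h (cardCompl S h)))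

theorem glue_left {m k : ℕ} (S : Finset (Fin (m + k))) (h : S.card = m) (σ : Equiv.Perm (Fin m))
    (i : ℕ) (hi : i < m) :
    glue m k S h σ ⟨i, by omega⟩ = S.orderEmbOfFin h (σ ⟨i, hi⟩) := by
  have : (⟨i, by omega⟩ : Fin (m + k)) = Fin.castAdd k ⟨i, hi⟩ := rfl
  rw [this]
  simp only [glue, Equiv.trans_apply, finSumFinEquiv_symm_apply_castAdd]
  simp

theorem glue_right {m k : ℕ} (S : Finset (Fin (m + k))) (h : S.card = m) (σ : Equiv.Perm (Fin m))
    (i : ℕ) (hi : i < k) :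
    glue m k S h σ ⟨m + i, by omega⟩ = Sᶜ.orderEmbOfFin (cardCompl S h) ⟨i, hi⟩ := by
  have : (⟨m + i, by omega⟩ : Fin (m + k)) = Fin.natAdd m ⟨i, hi⟩ := rfl
  rw [this]
  simp only [glue, Equiv.trans_apply, finSumFinEquiv_symm_apply_natAdd]
  simp

theorem glue_desc {m k : ℕ} (S : Finset (Fin (m + k))) (h : S.card = m) (σ : Equiv.Perm (Fin m)) :
    (descSet (m + k) (glue m k S h σ)).erase m = descSet m σ := by
  ext i
  rw [Finset.mem_erase, mem_descSet', mem_descSet']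
  constructor
  · rintro ⟨hne, hi, hlt⟩
    rcases lt_or_gt_of_ne hne with h1 | h1
    · refine ⟨⟨hi.1, h1⟩, ?_⟩
      rw [glue_left S h σ i h1, glue_left S h σ (i - 1) (by omega)] at hlt
      simpa using hlt
    · exfalso
      obtain ⟨j, rfl⟩ : ∃ j, i = m + (j + 1) := ⟨i - m - 1, by omega⟩
      have e : (⟨m + (j + 1) - 1, by omega⟩ : Fin (m + k)) = ⟨m + j, by omega⟩ := rfl
      rw [e, glue_right S h σ (j + 1) (by omega), glue_right S h σ j (by omega)] at hlt
      have := (OrderEmbedding.lt_iff_lt _).1 hlt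
      simp [Fin.lt_def] at this
  · rintro ⟨hi, hlt⟩
    refine ⟨by omega, ⟨hi.1, by omega⟩, ?_⟩
    rw [glue_left S h σ i hi.2, glue_left S h σ (i - 1) (by omega)]
    simpa using hlt

theorem glue_image {m k : ℕ} (S : Finset (Fin (m + k))) (h : S.card = m) (σ : Equiv.Perm (Fin m))
    (j : Fin (m + k)) : glue m k S h σ j ∈ S ↔ (j : ℕ) < m := by
  rcases lt_or_ge (j : ℕ) m with h1 | h1
  · have := glue_left S h σ j h1
    simp only [Fin.eta] at this
    rw [this]
    simp [h1, Finset.orderEmbOfFin_mem]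
  · have := glue_right S h σ (j - m) (by omega)
    have e : (⟨m + (j - m), by omega⟩ : Fin (m + k)) = j := by ext; simp; omega
    rw [e] at this
    have h2 := Finset.orderEmbOfFin_mem Sᶜ (cardCompl S h) ⟨j - m, by omega⟩
    rw [← this, Finset.mem_compl] at h2
    simp [h2, h1]

theorem glue_inj {m k : ℕ} (S S' : Finset (Fin (m + k))) (h : S.card = m) (h' : S'.card = m)
    (σ σ' : Equiv.Perm (Fin m)) (H : glue m k S h σ = glue m k S' h' σ') : S = S' ∧ σ = σ' := by
  have hS : S = S' := by
    ext x
    obtain ⟨j, rfl⟩ := (glue m k S h σ).surjective x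
    rw [glue_image]
    rw [H, glue_image]
  subst hS
  refine ⟨rfl, ?_⟩
  ext i
  have h1 := glue_left S h σ i i.2
  have h2 := glue_left S h' σ' i i.2
  rw [H, h2] at h1
  have := (Finset.orderEmbOfFin S h).injective h1
  simp at this
  rw [this]

theorem glue_surj {m k : ℕ} (π : Equiv.Perm (Fin (m + k)))
    (hπ : ∀ i ∈ descSet (m + k) π, i ≤ m) : ∃ S h σ, glue m k S h σ = π := by
  let S : Finset (Fin (m + k)) := Finset.univ.map ((Fin.castAddEmb k).trans π.toEmbedding)
  have h : S.card = m := by simp [S]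
  let e := finSumEquivOfFinset h (cardCompl S h)
  let τ : Equiv.Perm (Fin m ⊕ Fin k) := (finSumFinEquiv.trans π).trans e.symm
  have hτ : Set.MapsTo τ (Set.range Sum.inl) (Set.range Sum.inl) := by
    rintro _ ⟨i, rfl⟩
    have h1 : π (Fin.castAdd k i) ∈ S := by simp [S]
    have h2 : π (Fin.castAdd k i) ∈ Set.range (S.orderEmbOfFin h) := by
      rw [Finset.range_orderEmbOfFin]; exact h1
    obtain ⟨j, hj⟩ := h2
    refine ⟨j, ?_⟩
    simp only [τ, Equiv.trans_apply, finSumFinEquiv_apply_left]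
    rw [Equiv.eq_symm_apply]
    simp [e, hj]
  obtain ⟨⟨σ, ρ⟩, hσ⟩ := Equiv.Perm.mem_sumCongrHom_range_of_perm_mapsTo_inl hτ
  have hσ' : Equiv.Perm.sumCongr σ ρ = τ := hσ
  have key : ∀ j : Fin k, π (Fin.natAdd m j) = Sᶜ.orderEmbOfFin (cardCompl S h) (ρ j) := by
    intro j
    have := congrArg e (congrArg (fun f => f (Sum.inr j)) hσ')
    simp [τ, e] at this
    exact this.symm
  have mono : StrictMono ρ := by
    cases k with
    | zero => intro a; exact a.elim0
    | succ k =>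
      rw [Fin.strictMono_iff_lt_succ]
      intro i
      have h1 : m + (i + 1 : ℕ) ∉ descSet (m + (k + 1)) π := fun hc => by
        have := hπ _ hc
        omega
      rw [mem_descSet'] at h1
      push Not at h1
      have h2 := h1 ⟨by omega, by omega⟩
      have e1 : (⟨m + (i + 1 : ℕ), by omega⟩ : Fin (m + (k + 1))) = Fin.natAdd m i.succ := by
        ext; simp
      have e2 : (⟨m + (i + 1 : ℕ) - 1, by omega⟩ : Fin (m + (k + 1))) = Fin.natAdd m i.castSucc := by
        ext; simp
      rw [e1, e2, key, key, OrderEmbedding.le_iff_le] at h2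
      refine lt_of_le_of_ne h2 fun hc => ?_
      have := ρ.injective hc
      simp [Fin.ext_iff] at this
  have hρ : ρ = 1 := by
    ext i
    have h0 := Subsingleton.elim (mono.orderIsoOfSurjective ρ ρ.surjective) (OrderIso.refl (Fin k))
    have := congrArg (fun f : Fin k ≃o Fin k => f i) h0
    simp at this
    simp [this]
  refine ⟨S, h, σ, ?_⟩
  subst hρ
  ext x
  simp only [glue, hσ', τ, e]
  simp

theorem powCard (n m : ℕ) : (Finset.powersetCard m (Finset.univ : Finset (Fin n))).card =
    n.choose m := by simp

/-- For a family of subsets `S` whose glued permutations all have property `Des = J`. -/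
theorem glue_count_le {m k : ℕ} (A J : Finset ℕ) (T : Finset (Finset (Fin (m + k))))
    (hT : ∀ S ∈ T, S.card = m)
    (hJ : ∀ S ∈ T, ∀ h σ, descSet m σ = A → descSet (m + k) (glue m k S h σ) = J) :
    T.card * dA A m ≤ dA J (m + k) := by
  unfold dA
  rw [← Finset.card_product]
  refine Finset.card_le_card_of_injOn
    (fun x => if h : x.1.card = m then glue m k x.1 h x.2 else 1) ?_ ?_
  · rintro ⟨S, σ⟩ hx
    simp at hx
    simp [hT S hx.1, hJ S hx.1 _ σ hx.2]
  · rintro ⟨S, σ⟩ hx ⟨S', σ'⟩ hx' H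
    simp at hx hx'
    simp [hT S hx.1, hT S' hx'.1] at H
    obtain ⟨h1, h2⟩ := glue_inj _ _ _ _ _ _ H
    rw [h1, h2]

theorem recur {m k : ℕ} (A : Finset ℕ) (hA : ∀ x ∈ A, x < m) :
    dA (insert m A) (m + k) + dA A (m + k) = (m + k).choose m * dA A m := by
  have hmA : m ∉ A := fun h => lt_irrefl _ (hA m h)
  unfold dA
  rw [← powCard, ← Finset.card_product, ← Finset.card_union_of_disjoint]
  · symm
    refine Finset.card_bij
      (fun x hx => glue m k x.1 (by simp at hx; exact hx.1) x.2) ?_ ?_ ?_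
    · rintro ⟨S, σ⟩ hx
      simp at hx
      have := (glue_desc S hx.1 σ).trans hx.2
      simp only [Finset.mem_union, Finset.mem_filter, Finset.mem_univ, true_and]
      by_cases hm : m ∈ descSet (m + k) (glue m k S hx.1 σ)
      · left; exact (Finset.insert_erase hm).symm.trans (congrArg (insert m) this)
      · right; exact (Finset.erase_eq_of_notMem hm).symm.trans this
    · rintro ⟨S, σ⟩ hx ⟨S', σ'⟩ hx' H
      obtain ⟨h1, h2⟩ := glue_inj _ _ _ _ _ _ H
      exact Prod.ext h1 h2
    · intro π hπ
      simp at hπ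
      obtain ⟨S, h, σ, rfl⟩ := glue_surj π (by
        intro i hi
        rcases hπ with hπ | hπ
        · rw [hπ, Finset.mem_insert] at hi
          rcases hi with rfl | hi
          · exact le_rfl
          · exact (hA i hi).le
        · rw [hπ] at hi; exact (hA i hi).le)
      refine ⟨(S, σ), ?_, rfl⟩
      have := glue_desc S h σ
      simp only [Finset.mem_product, Finset.mem_powersetCard, Finset.mem_filter,
        Finset.mem_univ, Finset.subset_univ, true_and]
      refine ⟨h, ?_⟩
      rw [← this]
      rcases hπ with hπ | hπ
      · rw [hπ, Finset.erase_insert hmA]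
      · rw [hπ, Finset.erase_eq_of_notMem hmA]
  · rw [Finset.disjoint_left]
    intro π h1 h2
    simp at h1 h2
    rw [h1] at h2
    exact hmA (h2 ▸ Finset.mem_insert_self m A)

theorem mono_step {m : ℕ} (A : Finset ℕ) (hA : ∀ x ∈ A, x < m) :
    dA A m ≤ dA A (m + 1) := by
  have hmA : m ∉ A := fun h => lt_irrefl _ (hA m h)
  have := glue_count_le (m := m) (k := 1) A A {Finset.univ.erase (Fin.last m)} (by simp) (by
    intro S hS h σ hσ
    rw [Finset.mem_singleton] at hS
    have h1 := glue_desc S h σ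
    rw [hσ] at h1
    rw [← h1, Finset.erase_eq_of_notMem]
    rw [mem_descSet']
    rintro ⟨hi, hlt⟩
    have h2 := glue_image S h σ ⟨m, hi.2⟩
    simp [hS] at h2
    subst hS
    rw [h2] at hlt
    exact absurd hlt (not_lt.2 (Fin.le_last _)))
  simpa using this

theorem lower2 {m : ℕ} (hm : 0 < m) (A : Finset ℕ) :
    (m + 1) * dA A m ≤ dA (insert m A) (m + 2) := by
  have := glue_count_le (m := m) (k := 2) A (insert m A)
    (Finset.powersetCard m (Finset.univ.erase 0)) (by
      intro S hS; exact (Finset.mem_powersetCard.1 hS).2) (by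
    intro S hS h σ hσ
    have hS0 : (0 : Fin (m + 2)) ∉ S := fun h0 => by
      simpa using (Finset.mem_powersetCard.1 hS).1 h0
    have h1 := glue_desc S h σ
    rw [hσ] at h1
    rw [← h1, Finset.insert_erase]
    rw [mem_descSet']
    refine ⟨⟨hm, by omega⟩, ?_⟩
    have hz : glue m 2 S h σ ⟨m, by omega⟩ = 0 := by
      have h2 := glue_right S h σ 0 (by omega)
      have h3 : (0 : Fin (m + 2)) ∈ Set.range (Sᶜ.orderEmbOfFin (cardCompl S h)) := by
        rw [Finset.range_orderEmbOfFin]; simpa using hS0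
      obtain ⟨j, hj⟩ := h3
      have h4 : Sᶜ.orderEmbOfFin (cardCompl S h) ⟨0, by omega⟩ ≤ 0 := by
        rw [← hj, OrderEmbedding.le_iff_le]
        exact Fin.zero_le j
      have h5 := Fin.le_zero_iff.1 h4
      rw [h5] at h2
      exact h2
    rw [hz]
    rw [Fin.pos_iff_ne_zero, ← hz]
    intro hc
    have := (glue m 2 S h σ).injective hc
    simp [Fin.ext_iff] at this
    omega)
  rw [Finset.card_powersetCard, Finset.card_erase_of_mem (Finset.mem_univ _), Finset.card_univ,
    Fintype.card_fin] at this
  have e : (m + 2 - 1).choose m = m + 1 := by simp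
  rwa [e] at this

theorem upper1 {m : ℕ} (hm : 0 < m) (A : Finset ℕ) (hA : ∀ x ∈ A, x < m) :
    dA A (m + 1) ≤ m * dA A m := by
  have h1 := recur (k := 1) A hA
  have h3 : dA A m ≤ dA (insert m A) (m + 1) := by
    have := glue_count_le (m := m) (k := 1) A (insert m A) {Finset.univ.erase 0} (by simp) (by
      intro S hS h σ hσ
      rw [Finset.mem_singleton] at hS
      have h1 := glue_desc S h σ
      rw [hσ] at h1
      rw [← h1, Finset.insert_erase]
      rw [mem_descSet']
      refine ⟨⟨hm, by omega⟩, ?_⟩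
      have hz : glue m 1 S h σ ⟨m, by omega⟩ = 0 := by
        have h2 := glue_image S h σ ⟨m, by omega⟩
        simpa [hS] using h2
      rw [hz]
      rw [Fin.pos_iff_ne_zero, ← hz]
      intro hc
      have := (glue m 1 S h σ).injective hc
      simp [Fin.ext_iff] at this
      omega)
    simpa using this
  have e : (m + 1).choose m = m + 1 := by simp
  rw [e] at h1
  nlinarith

theorem mono_le {a n : ℕ} (A : Finset ℕ) (hA : ∀ x ∈ A, x < a) (h : a ≤ n) :
    dA A a ≤ dA A n := by
  induction n, h using Nat.le_induction with
  | base => exact le_rfl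
  | succ n hn ih => exact ih.trans (mono_step A fun x hx => (hA x hx).trans_le hn)

theorem dA_empty (n : ℕ) : dA ∅ n = 1 := by
  have h := recur (m := 0) (k := n) ∅ (by simp)
  have h1 : dA (insert 0 ∅) (0 + n) = 0 := by
    unfold dA
    rw [Finset.card_eq_zero, Finset.filter_eq_empty_iff]
    intro π _ hc
    have : 0 ∈ descSet (0 + n) π := by rw [hc]; simp
    rw [mem_descSet'] at this
    obtain ⟨h, _⟩ := this
    omega
  have h2 : dA ∅ 0 = 1 := by decide
  rw [h1, h2] at h
  simpa using h

theorem desc_neg_one (m : ℕ) :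
    (descPochhammer ℚ m).eval (-1) = (-1) ^ m * (m.factorial : ℚ) := by
  induction m with
  | zero => simp
  | succ m ih =>
    rw [descPochhammer_succ_eval, ih, Nat.factorial_succ]
    push_cast
    ring

theorem main_aux (I : Finset ℕ) : 0 ∉ I → ∃ p : Polynomial ℚ,
    (∀ n : ℕ, I.sup id < n → p.eval (n : ℚ) = dA I n) ∧
    0 ≤ (-1) ^ (I.sup id) * p.eval (-1) ∧
    (-1) ^ (I.sup id) * p.eval (-1) ≤ dA I (I.sup id + 2) := by
  induction I using Finset.induction_on_max with
  | empty =>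
    intro _
    refine ⟨1, ?_, ?_, ?_⟩
    · intro n _; simp [dA_empty]
    · simp
    · simp [dA_empty]
  | insert m A hA ih =>
    intro h0
    rw [Finset.mem_insert, not_or] at h0
    obtain ⟨q, hq, hq0, hq1⟩ := ih h0.2
    have hm : 0 < m := Nat.pos_of_ne_zero (Ne.symm h0.1)
    have hs : (insert m A).sup id = m := by
      rw [Finset.sup_insert]
      simp only [id]
      exact sup_eq_left.2 (Finset.sup_le fun x hx => (hA x hx).le)
    have ham : A.sup id < m := (Finset.sup_lt_iff (by simpa using hm)).2 hA
    have haA : ∀ x ∈ A, x < A.sup id + 1 := fun x hx =>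
      Nat.lt_succ_of_le (Finset.le_sup (f := id) hx)
    rw [hs]
    set a := A.sup id with ha
    have hfac : (m.factorial : ℚ) ≠ 0 := by positivity
    have hev : (-1 : ℚ) ^ m * (C ((dA A m : ℚ) / m.factorial) * descPochhammer ℚ m - q).eval (-1)
        = dA A m - (-1) ^ m * q.eval (-1) := by
      rw [eval_sub, eval_mul, eval_C, desc_neg_one]
      have : (-1 : ℚ) ^ m * (-1) ^ m = 1 := by rw [← mul_pow]; simp
      field_simp
      linear_combination (dA A m : ℚ) * this
    refine ⟨C ((dA A m : ℚ) / m.factorial) * descPochhammer ℚ m - q, ?_, ?_⟩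
    · intro n hn
      rw [eval_sub, eval_mul, eval_C, descPochhammer_eval_eq_descFactorial, hq n (ham.trans hn)]
      obtain ⟨k, rfl⟩ := Nat.exists_eq_add_of_lt hn
      have h1 := recur (k := k + 1) A hA
      rw [← add_assoc] at h1
      have h2 : (dA (insert m A) (m + k + 1) : ℚ) + dA A (m + k + 1)
        = (m + k + 1).choose m * dA A m := by exact_mod_cast h1
      rw [Nat.descFactorial_eq_factorial_mul_choose]
      push_cast at h2 ⊢
      field_simp
      linear_combination -h2
    · rw [hev]
      have L2 : ((m : ℚ) + 1) * dA A m ≤ dA (insert m A) (m + 2) := by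
        exact_mod_cast lower2 hm A
      have U1 : (dA A (m + 1) : ℚ) ≤ m * dA A m := by exact_mod_cast upper1 hm A hA
      have M1 : (dA A m : ℚ) ≤ dA A (m + 1) := by exact_mod_cast mono_step A hA
      have hx0 : (0 : ℚ) ≤ dA A m := by positivity
      set E : ℚ := (-1) ^ a * q.eval (-1) with hE
      have hub : E ≤ dA A (m + 1) := hq1.trans (by
        exact_mod_cast mono_le A (fun x hx => (haA x hx).trans (by omega)) (by omega))
      rcases Nat.even_or_odd (m - a) with hr | hr
      · have e1 : (-1 : ℚ) ^ m * q.eval (-1) = E := by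
          have : m = (m - a) + a := by omega
          rw [this, pow_add, hr.neg_one_pow, one_mul]
        rw [e1]
        have hub2 : E ≤ dA A m := hq1.trans (by
          obtain ⟨c, hc⟩ := hr
          exact_mod_cast mono_le A (fun x hx => (haA x hx).trans (by omega)) (by omega))
        constructor
        · linarith
        · nlinarith
      · have e1 : (-1 : ℚ) ^ m * q.eval (-1) = -E := by
          have : m = (m - a) + a := by omega
          rw [this, pow_add, hr.neg_one_pow, hE]; ring
        rw [e1]
        constructor
        · linarith
        · nlinarith

/-- Proposition 3.10: the sign of `d(I;−1)` is `(−1)^m`, i.e.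
`(−1)^m · d(I;−1) ≥ 0`. -/
theorem stmt_11 (I : Finset ℕ) (h0 : 0 ∉ I) (m : ℕ) (hm : m = I.sup id)
    (p : Polynomial ℚ) (hp : ∀ n : ℕ, m < n → p.eval (n : ℚ) = dA I n) :
    0 ≤ (-1) ^ m * p.eval (-1) := by
  subst hm
  obtain ⟨q, hq, hq0, -⟩ := main_aux I h0
  have : p = q := by
    apply Polynomial.eq_of_infinite_eval_eq
    refine Set.Infinite.mono ?_ ((Set.Ioi_infinite (I.sup id)).image
      (Nat.cast_injective (R := ℚ)).injOn)
    rintro _ ⟨n, hn, rfl⟩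
    simp only [Set.mem_ofPred_eq]
    rw [hp n hn, hq n hn]
  rw [this]
  exact hq0
end
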